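/- arXiv:2101.08765 — 5 statements merged into one kernel-verified Lean document; each statement's English description precedes it below -/
import Mathlib

section
/- Suppose I0 ⊆ {1,…,d} is a reference set with constant b > 0, I0 = {i : Q1_i = b·Q2_i} and |I0| > d/2, and let I1 = {1,…,d} \ I0 be the set of differential components. Then the noiseless RDB procedure is well defined at every step (i.e., S1(V(t)) > 0 and S2(V(t)) > 0 for each t ≤ T), it terminates at some step T with T ≤ |I1| + 1, and it recovers the truth exactly: Î0 = I0 and Î1 = I1, for any choice of medians at each step. -/
open Finset

/-- Sum of the vector `Q` over the index set `I`. -/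
noncomputable def S {d : ℕ} (Q : Fin d → ℝ) (I : Finset (Fin d)) : ℝ := ∑ i ∈ I, Q i

/-- Renormalized deviation `R_i(I) = Q1_i / S1(I) - Q2_i / S2(I)`. -/
noncomputable def Rdev {d : ℕ} (Q1 Q2 : Fin d → ℝ) (I : Finset (Fin d)) (i : Fin d) : ℝ :=
  Q1 i / S Q1 I - Q2 i / S Q2 I

/-- `m` is a median of the finite family `(x i)_{i ∈ I}`:
at least half of the values are `≤ m` and at least half are `≥ m`. -/
def IsMedian {ι : Type*} (I : Finset ι) (x : ι → ℝ) (m : ℝ) : Prop :=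
  I.card ≤ 2 * (I.filter fun i => x i ≤ m).card ∧
  I.card ≤ 2 * (I.filter fun i => m ≤ x i).card

/-- The set of components removed at a step of the noiseless RDB procedure, given the
current active set `V` and a median `m` of `(R_i(V))_{i ∈ V}`:
`W⁺ ∪ W⁻` if `m = 0`, `W⁻ ∪ W⁰` if `m > 0`, and `W⁺ ∪ W⁰` if `m < 0`. -/
noncomputable def Wstep {d : ℕ} (Q1 Q2 : Fin d → ℝ) (V : Finset (Fin d)) (m : ℝ) :
    Finset (Fin d) :=
  if m = 0 then V.filter fun i => Rdev Q1 Q2 V i ≠ 0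
  else if 0 < m then V.filter fun i => Rdev Q1 Q2 V i ≤ 0
  else V.filter fun i => 0 ≤ Rdev Q1 Q2 V i

theorem rdb_step {d : ℕ} (Q1 Q2 : Fin d → ℝ)
    (hQ1 : ∀ i, 0 ≤ Q1 i) (hQ2 : ∀ i, 0 ≤ Q2 i) (hQpos : ∀ i, 0 < Q1 i + Q2 i)
    (b : ℝ) (hb : 0 < b) (I0 : Finset (Fin d))
    (hI0 : ∀ i, i ∈ I0 ↔ Q1 i = b * Q2 i)
    (hI0card : d < 2 * I0.card) (V : Finset (Fin d)) (m : ℝ) (hV : I0 ⊆ V)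
    (hm : IsMedian V (Rdev Q1 Q2 V) m) :
    (0 < S Q1 V ∧ 0 < S Q2 V) ∧ (∀ i ∈ I0, i ∉ Wstep Q1 Q2 V m) ∧
      (Wstep Q1 Q2 V m = ∅ → V = I0) := by
  have hpos2 : ∀ i ∈ I0, 0 < Q2 i := by
    intro i hi
    have h1 := (hI0 i).1 hi
    have h2 := hQpos i
    rcases (hQ2 i).lt_or_eq with h | h
    · exact h
    · rw [h1, ← h] at h2
      simp at h2
  have hpos1 : ∀ i ∈ I0, 0 < Q1 i := by
    intro i hi
    rw [(hI0 i).1 hi]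
    exact mul_pos hb (hpos2 i hi)
  obtain ⟨j, hj⟩ : I0.Nonempty := by
    rw [← Finset.card_pos]; omega
  have hS1 : 0 < S Q1 V := Finset.sum_pos' (fun i _ => hQ1 i) ⟨j, hV hj, hpos1 j hj⟩
  have hS2 : 0 < S Q2 V := Finset.sum_pos' (fun i _ => hQ2 i) ⟨j, hV hj, hpos2 j hj⟩
  have hR0 : ∀ i ∈ I0, Rdev Q1 Q2 V i = Q2 i * (b / S Q1 V - 1 / S Q2 V) := by
    intro i hi
    rw [Rdev, (hI0 i).1 hi]
    ring
  have hRsum : ∑ i ∈ V, Rdev Q1 Q2 V i = 0 := by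
    simp only [Rdev, Finset.sum_sub_distrib, ← Finset.sum_div]
    change S Q1 V / S Q1 V - S Q2 V / S Q2 V = 0
    rw [div_self hS1.ne', div_self hS2.ne', sub_self]
  have hVd : V.card ≤ d := by simpa using Finset.card_le_univ V
  have hcard : ∀ (p : Fin d → Prop) [DecidablePred p],
      V.card ≤ 2 * (V.filter p).card → ∃ i ∈ I0, p i := by
    intro p _ h
    by_contra! hc
    have hsub : V.filter p ⊆ V \ I0 := by
      intro i hi
      rw [Finset.mem_filter] at hi
      rw [Finset.mem_sdiff]
      exact ⟨hi.1, fun h0 => hc i h0 hi.2⟩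
    have h1 := Finset.card_le_card hsub
    have h2 := Finset.card_sdiff_add_card_eq_card hV
    omega
  obtain ⟨i1, hi1, hle⟩ := hcard _ hm.1
  obtain ⟨i2, hi2, hge⟩ := hcard _ hm.2
  refine ⟨⟨hS1, hS2⟩, ?_⟩
  rcases lt_trichotomy (b / S Q1 V - 1 / S Q2 V) 0 with hc | hc | hc
  · have hneg : ∀ i ∈ I0, Rdev Q1 Q2 V i < 0 := fun i hi => by
      rw [hR0 i hi]; exact mul_neg_of_pos_of_neg (hpos2 i hi) hc
    have hm0 : m < 0 := lt_of_le_of_lt hge (hneg i2 hi2)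
    have hW : Wstep Q1 Q2 V m = V.filter fun i => 0 ≤ Rdev Q1 Q2 V i := by
      rw [Wstep, if_neg hm0.ne, if_neg hm0.not_gt]
    rw [hW]
    refine ⟨fun i hi h => ?_, fun h => ?_⟩
    · exact absurd (Finset.mem_filter.1 h).2 (hneg i hi).not_ge
    · exfalso
      rw [Finset.filter_eq_empty_iff] at h
      have := Finset.sum_neg (fun i hi => not_le.1 (h hi)) ⟨j, hV hj⟩
      linarith
  · have hz : ∀ i ∈ I0, Rdev Q1 Q2 V i = 0 := fun i hi => by
      rw [hR0 i hi, hc, mul_zero]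
    rw [hz i1 hi1] at hle
    rw [hz i2 hi2] at hge
    have hm0 : m = 0 := le_antisymm hge hle
    have hW : Wstep Q1 Q2 V m = V.filter fun i => Rdev Q1 Q2 V i ≠ 0 := by
      rw [Wstep, if_pos hm0]
    rw [hW]
    refine ⟨fun i hi h => (Finset.mem_filter.1 h).2 (hz i hi), fun h => ?_⟩
    rw [Finset.filter_eq_empty_iff] at h
    refine Finset.Subset.antisymm (fun i hi => ?_) hV
    have h1 : Rdev Q1 Q2 V i = 0 := not_not.1 (h hi)
    rw [hI0]
    rw [Rdev] at h1
    have h2 : (Q1 i - b * Q2 i) / S Q1 V = 0 := by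
      have : (Q1 i - b * Q2 i) / S Q1 V = (Q1 i / S Q1 V - Q2 i / S Q2 V)
        - Q2 i * (b / S Q1 V - 1 / S Q2 V) := by ring
      rw [this, h1, hc]; ring
    rcases div_eq_zero_iff.1 h2 with h3 | h3
    · linarith
    · exact absurd h3 hS1.ne'
  · have hpos : ∀ i ∈ I0, 0 < Rdev Q1 Q2 V i := fun i hi => by
      rw [hR0 i hi]; exact mul_pos (hpos2 i hi) hc
    have hm0 : 0 < m := lt_of_lt_of_le (hpos i1 hi1) hle
    have hW : Wstep Q1 Q2 V m = V.filter fun i => Rdev Q1 Q2 V i ≤ 0 := by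
      rw [Wstep, if_neg hm0.ne', if_pos hm0]
    rw [hW]
    refine ⟨fun i hi h => ?_, fun h => ?_⟩
    · exact absurd (Finset.mem_filter.1 h).2 (hpos i hi).not_ge
    · exfalso
      rw [Finset.filter_eq_empty_iff] at h
      have := Finset.sum_pos (fun i hi => not_le.1 (h hi)) ⟨j, hV hj⟩
      linarith

theorem Wstep_subset {d : ℕ} (Q1 Q2 : Fin d → ℝ) (V : Finset (Fin d)) (m : ℝ) :
    Wstep Q1 Q2 V m ⊆ V := by
  unfold Wstep
  split_ifs <;> exact Finset.filter_subset _ _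

/-- **Theorem 1 (noiseless RDB).** If `I0 = {i : Q1_i = b Q2_i}` is a reference set with
`|I0| > d/2` and `I1` its complement, then for any run of the noiseless RDB procedure
(with arbitrary choices of medians), the procedure is well defined at every step
(`S1(V t) > 0` and `S2(V t) > 0` for `t ≤ T`), stops at the first `T` with `W(T) = ∅`,
`T ≤ |I1| + 1`, and it recovers the truth exactly: `V T = I0` and `U T = I1`. -/
theorem rdb_noiseless_complete_recovery
    (d : ℕ) (hd : 1 ≤ d) (Q1 Q2 : Fin d → ℝ)
    (hQ1 : ∀ i, 0 ≤ Q1 i) (hQ2 : ∀ i, 0 ≤ Q2 i) (hQpos : ∀ i, 0 < Q1 i + Q2 i)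
    (hsum1 : ∑ i, Q1 i = 1) (hsum2 : ∑ i, Q2 i = 1)
    (b : ℝ) (hb : 0 < b)
    (I0 I1 : Finset (Fin d))
    (hI0 : I0 = Finset.univ.filter fun i => Q1 i = b * Q2 i)
    (hI0card : d < 2 * I0.card)
    (hI1 : I1 = Finset.univ \ I0)
    (V U : ℕ → Finset (Fin d)) (M : ℕ → ℝ)
    (hV0 : V 0 = Finset.univ) (hU0 : U 0 = ∅)
    (hM : ∀ t, IsMedian (V t) (Rdev Q1 Q2 (V t)) (M t))
    (hVstep : ∀ t, V (t + 1) = V t \ Wstep Q1 Q2 (V t) (M t))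
    (hUstep : ∀ t, U (t + 1) = U t ∪ Wstep Q1 Q2 (V t) (M t)) :
    ∃ T : ℕ,
      Wstep Q1 Q2 (V T) (M T) = ∅ ∧
      (∀ t < T, Wstep Q1 Q2 (V t) (M t) ≠ ∅) ∧
      T ≤ I1.card + 1 ∧
      V T = I0 ∧ U T = I1 ∧
      (∀ t ≤ T, 0 < S Q1 (V t) ∧ 0 < S Q2 (V t)) := by
  have hmem : ∀ i, i ∈ I0 ↔ Q1 i = b * Q2 i := by
    intro i; rw [hI0]; simp
  have hstep := fun t (h : I0 ⊆ V t) =>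
    rdb_step Q1 Q2 hQ1 hQ2 hQpos b hb I0 hmem hI0card (V t) (M t) h (hM t)
  have hinv : ∀ t, I0 ⊆ V t := by
    intro t
    induction t with
    | zero => rw [hV0]; exact Finset.subset_univ _
    | succ t ih =>
      intro i hi
      rw [hVstep, Finset.mem_sdiff]
      exact ⟨ih hi, (hstep t ih).2.1 i hi⟩
  have hU : ∀ t, U t = Finset.univ \ V t := by
    intro t
    induction t with
    | zero => rw [hV0, hU0]; simp
    | succ t ih =>
      rw [hVstep, hUstep, ih]
      ext i
      simp only [Finset.mem_union, Finset.mem_sdiff, Finset.mem_univ, true_and]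
      tauto
  have hcount : ∀ n, (∀ t < n, Wstep Q1 Q2 (V t) (M t) ≠ ∅) → (V n).card + n ≤ d := by
    intro n
    induction n with
    | zero => intro _; rw [hV0]; simp
    | succ n ih =>
      intro h
      have h1 := ih (fun t ht => h t (by omega))
      have h2 := Finset.card_sdiff_add_card_eq_card (Wstep_subset Q1 Q2 (V n) (M n))
      have h3 := Finset.card_pos.2 (Finset.nonempty_iff_ne_empty.2 (h n (by omega)))
      rw [← hVstep] at h2
      omega
  have hI1card : I1.card + I0.card = d := by
    rw [hI1, Finset.card_sdiff_add_card_eq_card (Finset.subset_univ _)]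
    simp
  have hex : ∃ T, Wstep Q1 Q2 (V T) (M T) = ∅ := by
    by_contra! hc
    have := hcount (d + 1) (fun t _ => (hc t).ne_empty)
    omega
  classical
  have hT := Nat.find_spec hex
  have hmin : ∀ t < Nat.find hex, Wstep Q1 Q2 (V t) (M t) ≠ ∅ :=
    fun t ht => Nat.find_min hex ht
  have hVT := (hstep _ (hinv (Nat.find hex))).2.2 hT
  refine ⟨Nat.find hex, hT, hmin, ?_, hVT, ?_, fun t _ => (hstep t (hinv t)).1⟩
  · have h1 := hcount _ hmin
    have h2 := Finset.card_le_card (hinv (Nat.find hex))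
    omega
  · rw [hU, hVT, hI1]
end

section
/- If I01 and I02 are reference sets with constants b1 > 0 and b2 > 0 respectively, and |I01| > d/2 and |I02| > d/2, then b1 = b2, and consequently the two reference-based hypotheses coincide: for every component i ∈ {1,…,d}, the equality Q1_i / ∑_{i'∈I01} Q1_{i'} = Q2_i / ∑_{i'∈I01} Q2_{i'} holds if and only if the equality Q1_i / ∑_{i'∈I02} Q1_{i'} = Q2_i / ∑_{i'∈I02} Q2_{i'} holds. -/
open Finset

theorem ref_key {d : ℕ} (Q1 Q2 : Fin d → ℝ)
    (hQ2 : ∀ i, 0 ≤ Q2 i) (hQpos : ∀ i, 0 < Q1 i + Q2 i)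
    (I : Finset (Fin d)) (b : ℝ) (hb : 0 < b)
    (href : ∀ i ∈ I, Q1 i = b * Q2 i) (hc : I.Nonempty) (i : Fin d) :
    (Q1 i / ∑ i' ∈ I, Q1 i' = Q2 i / ∑ i' ∈ I, Q2 i' ↔ Q1 i = b * Q2 i) := by
  have hpos : ∀ j ∈ I, 0 < Q2 j := by
    intro j hj
    rcases (hQ2 j).lt_or_eq with h | h
    · exact h
    · have h1 := hQpos j
      rw [href j hj, ← h] at h1
      simp at h1
  have hS : 0 < ∑ j ∈ I, Q2 j := Finset.sum_pos hpos hc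
  rw [Finset.sum_congr rfl href, ← Finset.mul_sum,
    div_eq_div_iff (mul_pos hb hS).ne' hS.ne']
  constructor
  · intro h
    apply mul_right_cancel₀ hS.ne'
    linarith
  · intro h
    rw [h]
    ring

/-- **Proposition 1, identifiability part.** If `I01` and `I02` are reference sets (with
constants `b1, b2 > 0`) each of cardinality strictly greater than `d/2`, then `b1 = b2` and
the reference-based null hypotheses defined by `I01` and `I02` coincide at every
component. -/
theorem reference_hypothesis_identifiable
    (d : ℕ) (hd : 1 ≤ d) (Q1 Q2 : Fin d → ℝ)
    (hQ1 : ∀ i, 0 ≤ Q1 i) (hQ2 : ∀ i, 0 ≤ Q2 i) (hQpos : ∀ i, 0 < Q1 i + Q2 i)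
    (hsum1 : ∑ i, Q1 i = 1) (hsum2 : ∑ i, Q2 i = 1)
    (I01 I02 : Finset (Fin d)) (b1 b2 : ℝ) (hb1 : 0 < b1) (hb2 : 0 < b2)
    (href1 : ∀ i ∈ I01, Q1 i = b1 * Q2 i) (href2 : ∀ i ∈ I02, Q1 i = b2 * Q2 i)
    (hc1 : d < 2 * I01.card) (hc2 : d < 2 * I02.card) :
    b1 = b2 ∧
    ∀ i : Fin d,
      (Q1 i / ∑ i' ∈ I01, Q1 i' = Q2 i / ∑ i' ∈ I01, Q2 i' ↔
       Q1 i / ∑ i' ∈ I02, Q1 i' = Q2 i / ∑ i' ∈ I02, Q2 i') := by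
  have hne : (I01 ∩ I02).Nonempty := by
    rw [← Finset.card_pos]
    have h1 := Finset.card_union_add_card_inter I01 I02
    have h2 := Finset.card_le_univ (I01 ∪ I02)
    rw [Fintype.card_fin] at h2
    omega
  obtain ⟨j, hj⟩ := hne
  obtain ⟨hj1, hj2⟩ := Finset.mem_inter.mp hj
  have e1 := href1 j hj1
  have e2 := href2 j hj2
  have hj0 : Q2 j ≠ 0 := by
    intro h
    have := hQpos j
    rw [e1, h] at this
    simp at this
  have hb : b1 = b2 := mul_right_cancel₀ hj0 (e1.symm.trans e2)
  refine ⟨hb, fun i => ?_⟩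
  rw [ref_key Q1 Q2 hQ2 hQpos I01 b1 hb1 href1 ⟨j, hj1⟩ i,
    ref_key Q1 Q2 hQ2 hQpos I02 b2 hb2 href2 ⟨j, hj2⟩ i, hb]
end

section
/- Let V ⊆ {1,…,d} be a disjoint union V = I0' ∪ I1' where I0' is nonempty, I1' is nonempty, S1(V) > 0 and S2(V) > 0, and there is b > 0 such that Q1_i = b·Q2_i for all i ∈ I0' while Q1_i ≠ b·Q2_i for all i ∈ I1'. Set β = b·S2(V)/S1(V). Then: (i) if β > 1, there exists i ∈ I1' with R_i(V) < 0; (ii) if β < 1, there exists i ∈ I1' with R_i(V) > 0; and (iii) if β = 1, then for every i ∈ V one has R_i(V) = 0 if and only if Q1_i = b·Q2_i, so R_i(V) ≠ 0 for every i ∈ I1'. Consequently, at a state V = I0' ∪ I1' with I1' nonempty, the selected set of components with sign opposite to (or, when β = 1, different from) the common sign of the reference deviations is nonempty. -/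
open Finset

/-- At a state `V = I0' ∪ I1'` (disjoint union, both parts nonempty) with
`Q1 = b·Q2` on `I0'` and `Q1 ≠ b·Q2` on `I1'`, setting `β = b·S2(V)/S1(V)`:
(i) if `β > 1` some `i ∈ I1'` has `R_i(V) < 0`; (ii) if `β < 1` some `i ∈ I1'` has
`R_i(V) > 0`; (iii) if `β = 1`, then for `i ∈ V`, `R_i(V) = 0 ↔ Q1_i = b·Q2_i`, so
`R_i(V) ≠ 0` for every `i ∈ I1'`. -/
theorem rdb_step_nonempty_selection
    (d : ℕ) (hd : 1 ≤ d) (Q1 Q2 : Fin d → ℝ)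
    (hQ1 : ∀ i, 0 ≤ Q1 i) (hQ2 : ∀ i, 0 ≤ Q2 i) (hQpos : ∀ i, 0 < Q1 i + Q2 i)
    (hsum1 : ∑ i, Q1 i = 1) (hsum2 : ∑ i, Q2 i = 1)
    (V I0' I1' : Finset (Fin d)) (hV : V = I0' ∪ I1') (hdisj : Disjoint I0' I1')
    (h0ne : I0'.Nonempty) (h1ne : I1'.Nonempty)
    (hS1 : 0 < S Q1 V) (hS2 : 0 < S Q2 V)
    (b : ℝ) (hb : 0 < b)
    (href : ∀ i ∈ I0', Q1 i = b * Q2 i) (hdiff : ∀ i ∈ I1', Q1 i ≠ b * Q2 i) :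
    (1 < b * S Q2 V / S Q1 V → ∃ i ∈ I1', Rdev Q1 Q2 V i < 0) ∧
    (b * S Q2 V / S Q1 V < 1 → ∃ i ∈ I1', 0 < Rdev Q1 Q2 V i) ∧
    (b * S Q2 V / S Q1 V = 1 →
      (∀ i ∈ V, (Rdev Q1 Q2 V i = 0 ↔ Q1 i = b * Q2 i)) ∧
      (∀ i ∈ I1', Rdev Q1 Q2 V i ≠ 0)) := by
  have hq : ∀ i ∈ I0', 0 < Q2 i := by
    intro i hi
    rcases (hQ2 i).lt_or_eq with h | h
    · exact h
    · have h1 := href i hi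
      have h2 := hQpos i
      rw [← h] at h1 h2
      simp only [mul_zero] at h1
      linarith
  have hR0 : ∀ i ∈ I0', Rdev Q1 Q2 V i = (b * S Q2 V / S Q1 V - 1) * (Q2 i / S Q2 V) := by
    intro i hi
    unfold Rdev
    rw [href i hi]
    field_simp
  have hsum : ∑ i ∈ I0', Rdev Q1 Q2 V i + ∑ i ∈ I1', Rdev Q1 Q2 V i = 0 := by
    rw [← Finset.sum_union hdisj, ← hV]
    unfold Rdev
    rw [Finset.sum_sub_distrib, ← Finset.sum_div, ← Finset.sum_div]
    change S Q1 V / S Q1 V - S Q2 V / S Q2 V = 0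
    rw [div_self hS1.ne', div_self hS2.ne', sub_self]
  refine ⟨fun hβ => ?_, fun hβ => ?_, fun hβ => ?_⟩
  · have hpos : 0 < ∑ i ∈ I0', Rdev Q1 Q2 V i := by
      refine Finset.sum_pos (fun i hi => ?_) h0ne
      rw [hR0 i hi]
      exact mul_pos (by linarith) (div_pos (hq i hi) hS2)
    by_contra! hcon
    have := Finset.sum_nonneg hcon
    linarith
  · have hneg : ∑ i ∈ I0', Rdev Q1 Q2 V i < 0 := by
      refine Finset.sum_neg (fun i hi => ?_) h0ne
      rw [hR0 i hi]
      exact mul_neg_of_neg_of_pos (by linarith) (div_pos (hq i hi) hS2)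
    by_contra! hcon
    have := Finset.sum_nonpos hcon
    linarith
  · have hS : S Q1 V = b * S Q2 V := by
      rw [div_eq_one_iff_eq hS1.ne'] at hβ
      exact hβ.symm
    have key : ∀ i, (Rdev Q1 Q2 V i = 0 ↔ Q1 i = b * Q2 i) := by
      intro i
      have h : Rdev Q1 Q2 V i = (Q1 i - b * Q2 i) / (b * S Q2 V) := by
        unfold Rdev
        rw [hS]
        field_simp
      rw [h, div_eq_zero_iff, sub_eq_zero]
      exact or_iff_left (mul_pos hb hS2).ne'
    exact ⟨fun i _ => key i, fun i hi h => hdiff i hi ((key i).1 h)⟩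
end

section
/- Let I0 be a nonempty reference set with constant b > 0 and let I be a subset with I0 ⊆ I ⊆ {1,…,d}, |I0| > |I|/2, S1(I) > 0 and S2(I) > 0. Then every median M(I) of the family (R_i(I))_{i∈I} has the same sign as b(I) − 1, where b(I) = b·S2(I)/S1(I): M(I) > 0 if b(I) > 1, M(I) = 0 if b(I) = 1, and M(I) < 0 if b(I) < 1. -/
open Finset

theorem exists_mem_of_half {ι : Type*} [DecidableEq ι] (I I0 F : Finset ι) (hsub : I0 ⊆ I)
    (hF : F ⊆ I) (h0 : I.card < 2 * I0.card) (h1 : I.card ≤ 2 * F.card) :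
    ∃ i ∈ I0, i ∈ F := by
  by_contra! h
  have hd : Disjoint I0 F := Finset.disjoint_left.2 h
  have h2 := Finset.card_le_card (Finset.union_subset hsub hF)
  rw [Finset.card_union_of_disjoint hd] at h2
  omega

/-- If `I0` is a nonempty reference set with constant `b > 0`, `I0 ⊆ I`, `|I0| > |I|/2`,
and `S1(I), S2(I) > 0`, then every median `m` of `(R_i(I))_{i ∈ I}` has the same sign as
`b(I) - 1` where `b(I) = b·S2(I)/S1(I)`. -/
theorem median_sign_matches_bI
    (d : ℕ) (hd : 1 ≤ d) (Q1 Q2 : Fin d → ℝ)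
    (hQ1 : ∀ i, 0 ≤ Q1 i) (hQ2 : ∀ i, 0 ≤ Q2 i) (hQpos : ∀ i, 0 < Q1 i + Q2 i)
    (hsum1 : ∑ i, Q1 i = 1) (hsum2 : ∑ i, Q2 i = 1)
    (b : ℝ) (hb : 0 < b)
    (I0 : Finset (Fin d)) (hI0ne : I0.Nonempty)
    (href : ∀ i ∈ I0, Q1 i = b * Q2 i)
    (I : Finset (Fin d)) (hsub : I0 ⊆ I) (hcard : I.card < 2 * I0.card)
    (hS1 : 0 < S Q1 I) (hS2 : 0 < S Q2 I)
    (m : ℝ) (hm : IsMedian I (Rdev Q1 Q2 I) m) :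
    (1 < b * S Q2 I / S Q1 I → 0 < m) ∧
    (b * S Q2 I / S Q1 I = 1 → m = 0) ∧
    (b * S Q2 I / S Q1 I < 1 → m < 0) := by
  obtain ⟨i, hi, hiF⟩ := exists_mem_of_half I I0 _ hsub (Finset.filter_subset _ _) hcard hm.1
  obtain ⟨j, hj, hjF⟩ := exists_mem_of_half I I0 _ hsub (Finset.filter_subset _ _) hcard hm.2
  have hi2 := (Finset.mem_filter.1 hiF).2
  have hj2 := (Finset.mem_filter.1 hjF).2
  have key : ∀ k ∈ I0, 0 < Q2 k / S Q2 I ∧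
      Rdev Q1 Q2 I k = Q2 k / S Q2 I * (b * S Q2 I / S Q1 I - 1) := by
    intro k hk
    have hpos : 0 < Q2 k := by
      rcases (hQ2 k).lt_or_eq with h | h
      · exact h
      · have h1 := href k hk
        have h2 := hQpos k
        rw [h1, ← h] at h2
        simp at h2
    refine ⟨div_pos hpos hS2, ?_⟩
    unfold Rdev
    rw [href k hk]
    have := hS1.ne'
    have := hS2.ne'
    field_simp
  obtain ⟨pi, ei⟩ := key i hi
  obtain ⟨pj, ej⟩ := key j hj
  rw [ei] at hi2
  rw [ej] at hj2
  refine ⟨fun h => ?_, fun h => ?_, fun h => ?_⟩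
  · exact lt_of_lt_of_le (mul_pos pi (sub_pos.2 h)) hi2
  · rw [h] at hi2 hj2
    simp at hi2 hj2
    exact le_antisymm hj2 hi2
  · exact lt_of_le_of_lt hj2 (mul_neg_of_pos_of_neg pj (sub_neg.2 h))
end

section
/- Suppose I0 ⊆ {1,…,d} is a reference set with constant b > 0, I0 = {i : Q1_i = b·Q2_i} and |I0| > d/2, and let I1 = {1,…,d} \ I0. Then the noiseless RDB procedure never removes a reference component: for every step t ≤ T one has I0 ⊆ V(t) and U(t) ⊆ I1 (in particular Î1 = U(T) ⊆ I1, i.e., no false discovery is ever made in the noiseless case), for any choice of medians at each step. -/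
open Finset

/-- A median's lower and upper halves both meet any strict majority of the index set. -/
theorem exists_mem_of_majority {ι : Type*} [DecidableEq ι] {A I F : Finset ι}
    (hA : A ⊆ I) (hF : F ⊆ I) (h1 : I.card < 2 * A.card) (h2 : I.card ≤ 2 * F.card) :
    ∃ i ∈ A, i ∈ F := by
  by_contra! h
  have hdis : Disjoint A F := Finset.disjoint_left.mpr h
  have h3 := Finset.card_le_card (Finset.union_subset hA hF)
  rw [Finset.card_union_of_disjoint hdis] at h3
  omega

/-- **No false discovery in the noiseless case.** If `I0 = {i : Q1_i = b Q2_i}` is a reference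
set with `|I0| > d/2` and `I1` its complement, then any run of the noiseless RDB procedure
(with arbitrary choices of medians) never removes a reference component: at every step `t`
(in particular at every `t ≤ T`, where `T` is the stopping time) one has `I0 ⊆ V t` and
`U t ⊆ I1`; in particular `Î1 = U T ⊆ I1`. -/
theorem rdb_noiseless_no_false_discovery
    (d : ℕ) (hd : 1 ≤ d) (Q1 Q2 : Fin d → ℝ)
    (hQ1 : ∀ i, 0 ≤ Q1 i) (hQ2 : ∀ i, 0 ≤ Q2 i) (hQpos : ∀ i, 0 < Q1 i + Q2 i)
    (hsum1 : ∑ i, Q1 i = 1) (hsum2 : ∑ i, Q2 i = 1)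
    (b : ℝ) (hb : 0 < b)
    (I0 I1 : Finset (Fin d))
    (hI0 : I0 = Finset.univ.filter fun i => Q1 i = b * Q2 i)
    (hI0card : d < 2 * I0.card)
    (hI1 : I1 = Finset.univ \ I0)
    (V U : ℕ → Finset (Fin d)) (M : ℕ → ℝ)
    (hV0 : V 0 = Finset.univ) (hU0 : U 0 = ∅)
    (hM : ∀ t, IsMedian (V t) (Rdev Q1 Q2 (V t)) (M t))
    (hVstep : ∀ t, V (t + 1) = V t \ Wstep Q1 Q2 (V t) (M t))
    (hUstep : ∀ t, U (t + 1) = U t ∪ Wstep Q1 Q2 (V t) (M t)) :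
    ∀ t : ℕ, I0 ⊆ V t ∧ U t ⊆ I1 := by
  have hcon : ∀ t, I0 ⊆ V t → Disjoint I0 (Wstep Q1 Q2 (V t) (M t)) := by
    intro t hsub
    have hcard : (V t).card < 2 * I0.card := by
      have := Finset.card_le_univ (V t)
      simp only [Fintype.card_fin] at this
      omega
    obtain ⟨i, hi, hiF⟩ := exists_mem_of_majority hsub (Finset.filter_subset _ _) hcard (hM t).1
    obtain ⟨j, hj, hjF⟩ := exists_mem_of_majority hsub (Finset.filter_subset _ _) hcard (hM t).2
    have hi2 := (Finset.mem_filter.mp hiF).2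
    have hj2 := (Finset.mem_filter.mp hjF).2
    have hR : ∀ k ∈ I0, 0 < Q2 k ∧
        Rdev Q1 Q2 (V t) k = Q2 k * (b / S Q1 (V t) - 1 / S Q2 (V t)) := by
      intro k hk
      rw [hI0, Finset.mem_filter] at hk
      have hk1 := hk.2
      refine ⟨?_, ?_⟩
      · rcases (hQ2 k).lt_or_eq with h | h
        · exact h
        · have := hQpos k
          rw [hk1, ← h] at this
          simp at this
      · unfold Rdev
        rw [hk1]
        ring
    generalize b / S Q1 (V t) - 1 / S Q2 (V t) = c at hR
    rw [Finset.disjoint_left]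
    intro k hk hkW
    obtain ⟨pi, ei⟩ := hR i hi
    obtain ⟨pj, ej⟩ := hR j hj
    obtain ⟨pk, ek⟩ := hR k hk
    rw [ei] at hi2
    rw [ej] at hj2
    unfold Wstep at hkW
    rcases lt_trichotomy c 0 with hc | hc | hc
    · have := mul_neg_of_pos_of_neg pj hc
      have hk0 := mul_neg_of_pos_of_neg pk hc
      have hm : M t < 0 := by linarith
      rw [if_neg hm.ne, if_neg hm.not_gt, Finset.mem_filter, ek] at hkW
      linarith [hkW.2]
    · subst hc
      have hm : M t = 0 := by linarith
      rw [if_pos hm, Finset.mem_filter, ek] at hkW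
      simp at hkW
    · have := mul_pos pi hc
      have hk0 := mul_pos pk hc
      have hm : 0 < M t := by linarith
      rw [if_neg hm.ne', if_pos hm, Finset.mem_filter, ek] at hkW
      linarith [hkW.2]
  intro t
  induction t with
  | zero => simp [hV0, hU0]
  | succ t ih =>
    have hd' := hcon t ih.1
    rw [hVstep, hUstep]
    refine ⟨Finset.subset_sdiff.mpr ⟨ih.1, hd'⟩, Finset.union_subset ih.2 ?_⟩
    rw [hI1]
    exact Finset.subset_sdiff.mpr ⟨Finset.subset_univ _, hd'.symm⟩
end
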